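/- Fix n ≥ 2 and r ≥ 2 and place r distinguishable rooks independently and uniformly at random on B_n. Let S_RR, S_CC, S_RC, S_CR be independent Poisson random variables with means E W_RR, E W_CC, E W_RC, E W_CR respectively (so E S_RR = E S_CC = binomial(r,2)·(4/(3n))·((n−1/2)/(n−1)) and E S_RC = E S_CR = binomial(r,2)·(2/(3n))·((n−2)/(n−1))). Then d_TV((W_RR, W_CC, W_RC, W_CR), (S_RR, S_CC, S_RC, S_CR)) ≤ d, where d := r(r−1)(r−3/2) · (362/(9n²)) · ((n(n − 301/181) + 166)/(n−1)²). -/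

import Mathlib

open Finset Filter

/-- The triangular board `B_n = {(i,j) : 1 ≤ i < j ≤ n}`. -/
def board (n : ℕ) : Finset (ℕ × ℕ) :=
  (Finset.range (n + 1) ×ˢ Finset.range (n + 1)).filter fun p => 1 ≤ p.1 ∧ p.1 < p.2

/-- Probability of event `E` when `r` distinguishable rooks are placed independently and
uniformly at random on `B_n`; a placement is a function `Fin r → ℕ × ℕ`, rook `a` sitting
on the square `f a = (row, column)`. -/
noncomputable def rookProb (n r : ℕ) (E : (Fin r → ℕ × ℕ) → Prop) : ℝ :=
  ({f : Fin r → ℕ × ℕ | (∀ a, f a ∈ board n) ∧ E f}.ncard : ℝ) / ((board n).card : ℝ) ^ r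

/-- Expectation of an `ℕ`-valued statistic of a uniform random placement of `r` rooks on `B_n`. -/
noncomputable def rookExp (n r : ℕ) (W : (Fin r → ℕ × ℕ) → ℕ) : ℝ :=
  (∑ f ∈ Fintype.piFinset (fun _ : Fin r => board n), (W f : ℝ)) / ((board n).card : ℝ) ^ r

/-- Number of (unordered) pairs of rooks lying in the same row. -/
def WRR (r : ℕ) (f : Fin r → ℕ × ℕ) : ℕ :=
  (Finset.univ.filter fun p : Fin r × Fin r => p.1 < p.2 ∧ (f p.1).1 = (f p.2).1).card

/-- Number of (unordered) pairs of rooks lying in the same column. -/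
def WCC (r : ℕ) (f : Fin r → ℕ × ℕ) : ℕ :=
  (Finset.univ.filter fun p : Fin r × Fin r => p.1 < p.2 ∧ (f p.1).2 = (f p.2).2).card

/-- Number of ordered pairs `a < b` with the column of rook `a` equal to the row of rook `b`. -/
def WRC (r : ℕ) (f : Fin r → ℕ × ℕ) : ℕ :=
  (Finset.univ.filter fun p : Fin r × Fin r => p.1 < p.2 ∧ (f p.1).2 = (f p.2).1).card

/-- Number of ordered pairs `a < b` with the row of rook `a` equal to the column of rook `b`. -/
def WCR (r : ℕ) (f : Fin r → ℕ × ℕ) : ℕ :=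
  (Finset.univ.filter fun p : Fin r × Fin r => p.1 < p.2 ∧ (f p.1).1 = (f p.2).2).card

/-- Commuting elements of a Banach algebra lie in a commutative Banach subalgebra. -/
theorem exists_commutative_banach_subalgebra {A : Type} [NormedRing A] [NormedAlgebra ℝ A]
    [CompleteSpace A] [NormOneClass A] (s : Set A) (hs : ∀ a ∈ s, ∀ b ∈ s, a * b = b * a) :
    ∃ (B : Type) (_ : NormedCommRing B) (_ : NormedAlgebra ℝ B) (_ : CompleteSpace B)
      (_ : NormOneClass B) (φ : B →ₐ[ℝ] A), (∀ x, ‖φ x‖ = ‖x‖) ∧ s ⊆ Set.range φ := by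
  let S₀ : Subalgebra ℝ A := Algebra.adjoin ℝ s
  let S : Subalgebra ℝ A := S₀.topologicalClosure
  have h₀ : ∀ x y : S₀, x * y = y * x :=
    (Algebra.isMulCommutative_adjoin ℝ hs).is_comm.comm
  have h₁ : ∀ x y : S, x * y = y * x :=
    (Subalgebra.commRingTopologicalClosure S₀ h₀).mul_comm
  refine ⟨S, { (inferInstance : NormedRing S) with mul_comm := h₁ },
    { (inferInstance : Algebra ℝ S) with
      norm_smul_le := fun a b => norm_smul_le a (b : A) },
    S₀.isClosed_topologicalClosure.completeSpace_coe, ⟨norm_one (α := A)⟩, S.val, fun _ => rfl, ?_⟩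
  exact fun a ha => ⟨⟨a, S₀.le_topologicalClosure (Algebra.subset_adjoin ha)⟩, rfl⟩

/-- Translation of bounded functions on a discrete additive monoid, as a bounded operator. -/
noncomputable def translationCLM {M : Type} [AddCommMonoid M] [TopologicalSpace M]
    [DiscreteTopology M] (m : M) :
    BoundedContinuousFunction M ℝ →L[ℝ] BoundedContinuousFunction M ℝ :=
  LinearMap.mkContinuous
    { toFun := fun f => f.compContinuous ⟨fun w => m + w, continuous_of_discreteTopology⟩
      map_add' := fun _ _ => rfl
      map_smul' := fun _ _ => rfl } 1 (fun f => by
        rw [one_mul]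
        exact (BoundedContinuousFunction.norm_le (norm_nonneg _)).2
          fun w => f.norm_coe_le_norm (m + w))

/-- Every commutative monoid maps to the unit ball of a commutative Banach algebra in such a way
that functions bounded by one on the monoid extend to functionals of norm at most one. -/
theorem exists_banach_algebra_of_addCommMonoid (M : Type) [AddCommMonoid M] :
    ∃ (B : Type) (_ : NormedCommRing B) (_ : NormedAlgebra ℝ B) (_ : CompleteSpace B)
      (_ : NormOneClass B) (τ : Multiplicative M →* B), (∀ m, ‖τ m‖ ≤ 1) ∧
      ∀ f : M → ℝ, (∀ m, |f m| ≤ 1) →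
        ∃ ℓ : B →L[ℝ] ℝ, (∀ T, |ℓ T| ≤ ‖T‖) ∧ ∀ m : M, ℓ (τ (Multiplicative.ofAdd m)) = f m := by
  let _ : TopologicalSpace M := ⊥
  have _ : DiscreteTopology M := ⟨rfl⟩
  have _ : Nontrivial (BoundedContinuousFunction M ℝ) :=
    ⟨⟨0, BoundedContinuousFunction.const M 1, fun h => zero_ne_one (DFunLike.congr_fun h (0 : M))⟩⟩
  have h_comm : ∀ a ∈ Set.range (translationCLM (M := M)), ∀ b ∈ Set.range
      (translationCLM (M := M)), a * b = b * a := by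
    rintro _ ⟨a, rfl⟩ _ ⟨b, rfl⟩
    ext f w
    change f (b + (a + w)) = f (a + (b + w))
    rw [add_left_comm]
  obtain ⟨B, i₁, i₂, i₃, i₄, φ, hφ, h_range⟩ := exists_commutative_banach_subalgebra
    (A := BoundedContinuousFunction M ℝ →L[ℝ] BoundedContinuousFunction M ℝ) _ h_comm
  have h_inj : Function.Injective φ := by
    rw [injective_iff_map_eq_zero]
    intro x hx
    have h := hφ x
    rw [hx] at h
    exact norm_eq_zero.1 (h.symm.trans
      (norm_zero (E := BoundedContinuousFunction M ℝ →L[ℝ] BoundedContinuousFunction M ℝ)))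
  choose t ht using fun m => h_range (Set.mem_range_self m)
  refine ⟨B, i₁, i₂, i₃, i₄,
    { toFun := fun m => t m.toAdd
      map_one' := ?_
      map_mul' := ?_ }, ?_, ?_⟩
  · apply h_inj
    rw [ht, map_one φ]
    ext f w
    change f (0 + w) = f w
    rw [zero_add]
  · intro a b
    apply h_inj
    rw [map_mul φ, ht, ht, ht]
    ext f w
    change f (a.toAdd + b.toAdd + w) = f (b.toAdd + (a.toAdd + w))
    rw [add_left_comm, add_assoc]
  · intro m
    change ‖t m.toAdd‖ ≤ 1
    rw [← hφ, ht]
    exact LinearMap.mkContinuous_norm_le _ zero_le_one _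
  · intro f hf
    let F : BoundedContinuousFunction M ℝ := BoundedContinuousFunction.ofNormedAddCommGroup f
      continuous_of_discreteTopology 1 hf
    have hF : ‖F‖ ≤ 1 := BoundedContinuousFunction.norm_ofNormedAddCommGroup_le _ zero_le_one hf
    have h_bd : ∀ T : B, ‖φ T F 0‖ ≤ 1 * ‖T‖ := fun T => by
      calc ‖φ T F 0‖ ≤ ‖φ T F‖ := BoundedContinuousFunction.norm_coe_le_norm _ _
        _ ≤ ‖φ T‖ * ‖F‖ := ContinuousLinearMap.le_opNorm _ _
        _ ≤ ‖φ T‖ * 1 := by gcongr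
        _ = 1 * ‖T‖ := by rw [mul_one, one_mul, hφ]
    refine ⟨LinearMap.mkContinuous
      { toFun := fun T => φ T F 0
        map_add' := fun _ _ => by rw [map_add]; rfl
        map_smul' := fun _ _ => by rw [map_smul]; rfl } 1 h_bd,
      fun T => (h_bd T).trans_eq (one_mul _), fun m => ?_⟩
    change φ (t m) F 0 = f m
    rw [ht]
    change f (m + 0) = f m
    rw [add_zero]

section PoissonInterpolation

variable {B : Type} [NormedCommRing B]

theorem exp_smul_sub_one [NormedAlgebra ℝ B] [CompleteSpace B] (c : ℝ) (e : B) :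
    NormedSpace.exp (c • (e - 1)) = Real.exp (-c) • NormedSpace.exp (c • e) := by
  let _ : NormedAlgebra ℚ B := NormedAlgebra.restrictScalars ℚ ℝ B
  have h_eq : c • (e - 1) = algebraMap ℝ B (-c) + c • e := by
    rw [Algebra.algebraMap_eq_smul_one, smul_sub, neg_smul]; abel
  rw [h_eq, NormedSpace.exp_add, ← NormedSpace.algebraMap_exp_comm, ← Real.exp_eq_exp_ℝ,
    ← Algebra.smul_def]

variable [NormOneClass B]

theorem norm_prod_le_one {ι : Type*} (s : Finset ι) (u : ι → B) (hu : ∀ i ∈ s, ‖u i‖ ≤ 1) :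
    ‖∏ i ∈ s, u i‖ ≤ 1 :=
  (Finset.norm_prod_le s u).trans (Finset.prod_le_one (fun _ _ => norm_nonneg _) hu)

theorem norm_mul_prod_sub_one_le {ι : Type*} [DecidableEq ι] (d : B) (s : Finset ι) (u : ι → B)
    (hu : ∀ i ∈ s, ‖u i‖ ≤ 1) :
    ‖d * (∏ i ∈ s, u i - 1)‖ ≤ ∑ i ∈ s, ‖d * (u i - 1)‖ := by
  induction s using Finset.induction_on with
  | empty => simp
  | insert a s ha ih =>
    rw [Finset.prod_insert ha, Finset.sum_insert ha]
    have h₁ := ih fun i hi => hu i (Finset.mem_insert_of_mem hi)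
    have h₂ := norm_prod_le_one s u fun i hi => hu i (Finset.mem_insert_of_mem hi)
    have h₃ := hu a (Finset.mem_insert_self a s)
    have h_eq : d * (u a * ∏ i ∈ s, u i - 1) =
        d * (u a - 1) + u a * (d * (∏ i ∈ s, u i - 1)) := by ring
    rw [h_eq]
    refine (norm_add_le _ _).trans (add_le_add le_rfl ?_)
    refine (norm_mul_le _ _).trans ?_
    calc ‖u a‖ * ‖d * (∏ i ∈ s, u i - 1)‖ ≤ 1 * ‖d * (∏ i ∈ s, u i - 1)‖ := by gcongr
      _ ≤ _ := by rw [one_mul]; exact h₁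

theorem norm_mul_prod_sub_prod_le {ι : Type*} [DecidableEq ι] (d : B) {s t : Finset ι}
    (hst : s ⊆ t) (u : ι → B) (hu : ∀ i ∈ t, ‖u i‖ ≤ 1) :
    ‖d * (∏ i ∈ t, u i - ∏ i ∈ s, u i)‖ ≤ ∑ i ∈ t \ s, ‖d * (u i - 1)‖ := by
  have h_eq : d * (∏ i ∈ t, u i - ∏ i ∈ s, u i) =
      (∏ i ∈ s, u i) * (d * (∏ i ∈ t \ s, u i - 1)) := by
    rw [← Finset.prod_sdiff hst]; ring
  rw [h_eq]
  refine (norm_mul_le _ _).trans ?_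
  have h₁ := norm_prod_le_one s u fun i hi => hu i (hst hi)
  have h₂ := norm_mul_prod_sub_one_le d (t \ s) u fun i hi => hu i (Finset.sdiff_subset hi)
  calc _ ≤ 1 * ‖d * (∏ i ∈ t \ s, u i - 1)‖ := by gcongr
    _ ≤ _ := by rw [one_mul]; exact h₂

theorem norm_sub_one_mul_sub_one_le {e e' : B} (he : ‖e‖ ≤ 1) (he' : ‖e'‖ ≤ 1) :
    ‖(e - 1) * (e' - 1)‖ ≤ 4 := by
  have h₁ : ‖e - 1‖ ≤ 2 := (norm_sub_le _ _).trans (by rw [norm_one]; linarith)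
  have h₂ : ‖e' - 1‖ ≤ 2 := (norm_sub_le _ _).trans (by rw [norm_one]; linarith)
  refine (norm_mul_le _ _).trans ?_
  nlinarith [norm_nonneg (e - 1), norm_nonneg (e' - 1)]

variable [NormedAlgebra ℝ B]

theorem norm_one_add_smul_sub_one_le {e : B} (he : ‖e‖ ≤ 1) {c : ℝ} (h₀ : 0 ≤ c) (h₁ : c ≤ 1) :
    ‖1 + c • (e - 1)‖ ≤ 1 := by
  have h_eq : 1 + c • (e - 1) = (1 - c) • (1 : B) + c • e := by
    rw [smul_sub, sub_smul, one_smul]; abel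
  rw [h_eq]
  refine (norm_add_le _ _).trans ?_
  rw [norm_smul, norm_smul, norm_one, Real.norm_of_nonneg h₀, Real.norm_of_nonneg (by linarith)]
  nlinarith

variable [CompleteSpace B]

theorem norm_exp_le_exp_norm (x : B) : ‖NormedSpace.exp x‖ ≤ Real.exp ‖x‖ := by
  have h₁ := NormedSpace.exp_series_hasSum_exp' (𝕂 := ℝ) x
  have h₂ := NormedSpace.exp_series_hasSum_exp' (𝕂 := ℝ) ‖x‖
  rw [← Real.exp_eq_exp_ℝ] at h₂
  refine h₁.norm_le_of_bounded h₂ fun n => ?_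
  rw [norm_smul, smul_eq_mul, Real.norm_of_nonneg (by positivity)]
  gcongr
  exact norm_pow_le x n

theorem norm_exp_smul_sub_one_le {e : B} (he : ‖e‖ ≤ 1) {c : ℝ} (hc : 0 ≤ c) :
    ‖NormedSpace.exp (c • (e - 1))‖ ≤ 1 := by
  rw [exp_smul_sub_one, norm_smul, Real.norm_of_nonneg (Real.exp_nonneg _), Real.exp_neg]
  refine inv_mul_le_one_of_le₀ ((norm_exp_le_exp_norm _).trans ?_) (Real.exp_nonneg _)
  rw [norm_smul, Real.norm_of_nonneg hc]
  exact Real.exp_le_exp.2 (mul_le_of_le_one_right hc he)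

/-- Poisson approximation for sums of locally dependent indicators `X i`, in a commutative Banach
algebra: `nbhd i` is the neighbourhood of dependence of `i`, and expectations are sums over `P`. -/
theorem norm_sum_prod_sub_exp_le {Ω ι : Type*} [Fintype ι] [DecidableEq ι] (P : Finset Ω)
    (X : ι → Ω → ℝ) (hX : ∀ i ω, X i ω = 0 ∨ X i ω = 1) (p : ι → ℝ) (hp : ∀ i, 0 ≤ p i)
    (e : ι → B) (he : ∀ i, ‖e i‖ ≤ 1) (nbhd : ι → Finset ι) (h_self : ∀ i, i ∈ nbhd i)
    (h_sum : ∀ i, ∑ ω ∈ P, X i ω = p i * P.card)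
    (h_indep : ∀ i, ∀ G : Ω → B, (∀ ω ω', (∀ j ∉ nbhd i, X j ω = X j ω') → G ω = G ω') →
      ∑ ω ∈ P, X i ω • G ω = p i • ∑ ω ∈ P, G ω) :
    ‖∑ ω ∈ P, ∏ i, (1 + X i ω • (e i - 1)) -
        (P.card : ℝ) • NormedSpace.exp (∑ i, p i • (e i - 1))‖ ≤
      2 * (∑ i, ∑ j ∈ nbhd i, p i * p j * P.card +
        ∑ i, ∑ j ∈ (nbhd i).erase i, ∑ ω ∈ P, X i ω * X j ω) := by
  let _ : NormedAlgebra ℚ B := NormedAlgebra.restrictScalars ℚ ℝ B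
  set C : ℝ := ∑ i, ∑ j ∈ nbhd i, p i * p j * P.card +
        ∑ i, ∑ j ∈ (nbhd i).erase i, ∑ ω ∈ P, X i ω * X j ω with hC
  have hX₀ : ∀ i ω, 0 ≤ X i ω := fun i ω => by rcases hX i ω with h | h <;> simp [h]
  have hX₁ : ∀ i ω, X i ω ≤ 1 := fun i ω => by rcases hX i ω with h | h <;> simp [h]
  set L : B := ∑ i, p i • (e i - 1) with hL
  let u : ℝ → ι → Ω → B := fun s i ω => 1 + (s * X i ω) • (e i - 1)
  have hu : ∀ s ∈ Set.Icc (0 : ℝ) 1, ∀ i ω, ‖u s i ω‖ ≤ 1 := fun s hs i ω =>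
    norm_one_add_smul_sub_one_le (he i) (mul_nonneg hs.1 (hX₀ i ω))
      (mul_le_one₀ hs.2 (hX₀ i ω) (hX₁ i ω))
  let Φ : ℝ → B := fun s => (∑ ω ∈ P, ∏ i, u s i ω) * NormedSpace.exp ((1 - s) • L)
  let Φ' : ℝ → B := fun s => (∑ i, (∑ ω ∈ P, X i ω • ((e i - 1) * ∏ j ∈ univ.erase i, u s j ω) -
    p i • ∑ ω ∈ P, (e i - 1) * ∏ j, u s j ω)) * NormedSpace.exp ((1 - s) • L)
  have h_deriv : ∀ s, HasDerivAt Φ (Φ' s) s := by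
    intro s
    have h₁ : HasDerivAt (fun s => ∑ ω ∈ P, ∏ i, u s i ω)
        (∑ ω ∈ P, ∑ i, (∏ j ∈ univ.erase i, u s j ω) • (X i ω • (e i - 1))) s := by
      refine HasDerivAt.fun_sum fun ω _ => HasDerivAt.fun_finsetProd fun i _ => ?_
      have h := ((hasDerivAt_mul_const (x := s) (X i ω)).smul_const (e i - 1)).const_add (1 : B)
      exact h
    have h₂ : HasDerivAt (fun s : ℝ => NormedSpace.exp ((1 - s) • L))
        ((-1 : ℝ) • (NormedSpace.exp ((1 - s) • L) * L)) s :=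
      (hasDerivAt_exp_smul_const L (1 - s)).scomp s ((hasDerivAt_id s).const_sub 1)
    refine (h₁.mul h₂).congr_deriv (Eq.symm ?_)
    change (∑ i, (_ - _)) * _ = _
    rw [Finset.sum_sub_distrib, sub_mul]
    rw [neg_one_smul, mul_neg, ← sub_eq_add_neg]
    congr 1
    · rw [Finset.sum_comm]
      congr 1
      refine Finset.sum_congr rfl fun ω _ => Finset.sum_congr rfl fun i _ => ?_
      rw [smul_eq_mul, mul_smul_comm, mul_comm]
    · simp_rw [← Finset.mul_sum]
      rw [mul_comm (NormedSpace.exp _) L, ← mul_assoc]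
      congr 1
      rw [mul_comm, hL, Finset.sum_mul]
      refine Finset.sum_congr rfl fun i _ => ?_
      rw [smul_mul_assoc]
  have h_exp : ∀ s ∈ Set.Icc (0 : ℝ) 1, ‖NormedSpace.exp ((1 - s) • L)‖ ≤ 1 := by
    intro s hs
    rw [hL, Finset.smul_sum, NormedSpace.exp_sum]
    refine norm_prod_le_one _ _ fun i _ => ?_
    rw [smul_smul]
    exact norm_exp_smul_sub_one_le (he i) (mul_nonneg (sub_nonneg.2 hs.2) (hp i))
  have h_bound : ∀ s ∈ Set.Ico (0 : ℝ) 1, ‖Φ' s‖ ≤ 4 * C * s := by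
    intro s hs
    have hs' : s ∈ Set.Icc (0 : ℝ) 1 := ⟨hs.1, hs.2.le⟩
    have h_diff : ∀ i j ω, ‖(e i - 1) * (u s j ω - 1)‖ ≤ 4 * s * X j ω := by
      intro i j ω
      simp only [u]
      rw [add_sub_cancel_left, mul_smul_comm, norm_smul,
        Real.norm_of_nonneg (mul_nonneg hs.1 (hX₀ j ω))]
      nlinarith [norm_sub_one_mul_sub_one_le (he i) (he j), mul_nonneg hs.1 (hX₀ j ω)]
    have h_term : ∀ i, ‖∑ ω ∈ P, X i ω • ((e i - 1) * ∏ j ∈ univ.erase i, u s j ω) -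
        p i • ∑ ω ∈ P, (e i - 1) * ∏ j, u s j ω‖ ≤
        4 * s * (∑ j ∈ nbhd i, p i * p j * P.card +
          ∑ j ∈ (nbhd i).erase i, ∑ ω ∈ P, X i ω * X j ω) := by
      intro i
      have h_ind := h_indep i (fun ω => (e i - 1) * ∏ j ∈ (nbhd i)ᶜ, u s j ω) (by
        intro ω ω' h
        refine congrArg _ (Finset.prod_congr rfl fun j hj => ?_)
        simp only [u]
        rw [h j (Finset.mem_compl.1 hj)])
      have h_eq : ∑ ω ∈ P, X i ω • ((e i - 1) * ∏ j ∈ univ.erase i, u s j ω) -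
          p i • ∑ ω ∈ P, (e i - 1) * ∏ j, u s j ω =
          ∑ ω ∈ P, X i ω • ((e i - 1) * (∏ j ∈ univ.erase i, u s j ω -
            ∏ j ∈ (nbhd i)ᶜ, u s j ω)) -
          p i • ∑ ω ∈ P, (e i - 1) * (∏ j, u s j ω - ∏ j ∈ (nbhd i)ᶜ, u s j ω) := by
        have h_split : ∀ s' : Finset ι, ∀ ω, (e i - 1) * (∏ j ∈ s', u s j ω -
            ∏ j ∈ (nbhd i)ᶜ, u s j ω) = (e i - 1) * ∏ j ∈ s', u s j ω -
            (e i - 1) * ∏ j ∈ (nbhd i)ᶜ, u s j ω := fun _ _ => mul_sub _ _ _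
        simp_rw [h_split, smul_sub, Finset.sum_sub_distrib]
        rw [h_ind, smul_sub]
        abel
      rw [h_eq]
      have h_sub : (nbhd i)ᶜ ⊆ univ.erase i := fun j hj => by
        refine Finset.mem_erase.2 ⟨?_, Finset.mem_univ j⟩
        rintro rfl
        exact Finset.mem_compl.1 hj (h_self j)
      have h_set : univ.erase i \ (nbhd i)ᶜ = (nbhd i).erase i := by
        ext j; simp
      have h_a : ‖∑ ω ∈ P, X i ω • ((e i - 1) * (∏ j ∈ univ.erase i, u s j ω -
            ∏ j ∈ (nbhd i)ᶜ, u s j ω))‖ ≤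
          4 * s * ∑ j ∈ (nbhd i).erase i, ∑ ω ∈ P, X i ω * X j ω := by
        rw [Finset.sum_comm, Finset.mul_sum]
        refine (norm_sum_le _ _).trans (Finset.sum_le_sum fun ω _ => ?_)
        rw [norm_smul, Real.norm_of_nonneg (hX₀ i ω)]
        have h := (norm_mul_prod_sub_prod_le (e i - 1) h_sub (fun j => u s j ω)
          fun j _ => hu s hs' j ω).trans (Finset.sum_le_sum fun j _ => h_diff i j ω)
        rw [h_set, ← Finset.mul_sum] at h
        rw [← Finset.mul_sum]
        nlinarith [hX₀ i ω, mul_le_mul_of_nonneg_left h (hX₀ i ω)]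
      have h_b : ‖p i • ∑ ω ∈ P, (e i - 1) * (∏ j, u s j ω - ∏ j ∈ (nbhd i)ᶜ, u s j ω)‖ ≤
          4 * s * ∑ j ∈ nbhd i, p i * p j * P.card := by
        rw [norm_smul, Real.norm_of_nonneg (hp i)]
        have h : ‖∑ ω ∈ P, (e i - 1) * (∏ j, u s j ω - ∏ j ∈ (nbhd i)ᶜ, u s j ω)‖ ≤
            ∑ ω ∈ P, ∑ j ∈ nbhd i, 4 * s * X j ω := by
          refine (norm_sum_le _ _).trans (Finset.sum_le_sum fun ω _ => ?_)
          have h := (norm_mul_prod_sub_prod_le (e i - 1) (Finset.subset_univ (nbhd i)ᶜ)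
            (fun j => u s j ω) fun j _ => hu s hs' j ω).trans
            (Finset.sum_le_sum fun j _ => h_diff i j ω)
          rwa [← Finset.compl_eq_univ_sdiff, compl_compl] at h
        have h_eq' : ∑ ω ∈ P, ∑ j ∈ nbhd i, 4 * s * X j ω =
            4 * s * ∑ j ∈ nbhd i, p j * P.card := by
          rw [Finset.sum_comm, Finset.mul_sum]
          refine Finset.sum_congr rfl fun j _ => ?_
          rw [← Finset.mul_sum, h_sum j]
        rw [h_eq'] at h
        refine (mul_le_mul_of_nonneg_left h (hp i)).trans_eq ?_
        simp_rw [mul_assoc (p i), ← Finset.mul_sum]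
        ring
      refine (norm_sub_le _ _).trans ((add_le_add h_a h_b).trans_eq ?_)
      ring
    calc ‖Φ' s‖ ≤ _ := norm_mul_le _ _
      _ ≤ (∑ i, 4 * s * (∑ j ∈ nbhd i, p i * p j * P.card +
          ∑ j ∈ (nbhd i).erase i, ∑ ω ∈ P, X i ω * X j ω)) * 1 :=
        mul_le_mul ((norm_sum_le _ _).trans (Finset.sum_le_sum fun i _ => h_term i))
          (h_exp s hs') (norm_nonneg _) ((norm_nonneg _).trans
            ((norm_sum_le _ _).trans (Finset.sum_le_sum fun i _ => h_term i)))
      _ = 4 * C * s := by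
        rw [mul_one, ← Finset.mul_sum, hC, Finset.sum_add_distrib]; ring
  have h_main := image_norm_le_of_norm_deriv_right_le_deriv_boundary
    (f := fun s => Φ s - Φ 0) (f' := Φ') (a := 0) (b := 1) (B := fun s => 2 * C * s ^ 2)
    (B' := fun s => 4 * C * s)
    (fun s _ => ((h_deriv s).sub_const _).continuousAt.continuousWithinAt)
    (fun s _ => ((h_deriv s).sub_const _).hasDerivWithinAt)
    (by simp)
    (fun s => by
      refine ((hasDerivAt_pow 2 s).const_mul (2 * C)).congr_deriv ?_
      norm_num
      ring)
    h_bound (Set.right_mem_Icc.2 zero_le_one)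
  simpa [Φ, u, Algebra.smul_def] using h_main

end PoissonInterpolation

set_option linter.deprecated false

open ProbabilityTheory in
theorem hasSum_poissonPMFReal_smul_pow {B : Type} [NormedCommRing B] [NormedAlgebra ℝ B]
    [CompleteSpace B] (lam : NNReal) (e : B) :
    HasSum (fun k => poissonPMFReal lam k • e ^ k)
      (NormedSpace.exp ((lam : ℝ) • (e - 1))) := by
  rw [exp_smul_sub_one]
  convert (NormedSpace.exp_series_hasSum_exp' (𝕂 := ℝ) ((lam : ℝ) • e)).const_smul
    (Real.exp (-lam)) using 2 with k
  rw [smul_pow, smul_smul, smul_smul, poissonPMFReal]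
  congr 1
  ring

open ProbabilityTheory in
theorem summable_norm_poissonPMFReal_smul_pow {B : Type} [NormedCommRing B] [NormedAlgebra ℝ B]
    [NormOneClass B] (lam : NNReal) {e : B} (he : ‖e‖ ≤ 1) :
    Summable fun k => ‖poissonPMFReal lam k • e ^ k‖ := by
  refine (poissonPMFRealSum lam).summable.of_nonneg_of_le (fun _ => norm_nonneg _) fun k => ?_
  rw [norm_smul, Real.norm_of_nonneg poissonPMFReal_nonneg]
  exact mul_le_of_le_one_right poissonPMFReal_nonneg
    ((norm_pow_le e k).trans (pow_le_one₀ (norm_nonneg _) he))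

theorem HasSum.mul_with_norm {ι ι' B : Type*} [NormedCommRing B] [CompleteSpace B] {f : ι → B}
    {g : ι' → B} {a b : B} (hf : HasSum f a ∧ Summable fun i => ‖f i‖)
    (hg : HasSum g b ∧ Summable fun i => ‖g i‖) :
    HasSum (fun z : ι × ι' => f z.1 * g z.2) (a * b) ∧
      Summable fun z : ι × ι' => ‖f z.1 * g z.2‖ :=
  ⟨hf.1.mul hg.1 (summable_mul_of_summable_norm hf.2 hg.2), hf.2.mul_norm hg.2⟩

theorem hasSum_mul_four {B : Type*} [NormedCommRing B] [CompleteSpace B] {g : Fin 4 → ℕ → B}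
    {y : Fin 4 → B} (h : ∀ k, HasSum (g k) (y k) ∧ Summable fun m => ‖g k m‖) :
    HasSum (fun w : ℕ × ℕ × ℕ × ℕ => g 0 w.1 * (g 1 w.2.1 * (g 2 w.2.2.1 * g 3 w.2.2.2)))
      (y 0 * (y 1 * (y 2 * y 3))) := by
  have h₂ := HasSum.mul_with_norm (h 2) (h 3)
  have h₁ := HasSum.mul_with_norm (h 1) h₂
  have h₀ := HasSum.mul_with_norm (h 0) h₁
  exact h₀.1

/-- Total variation bound, by independent Poisson variables, for the four counts of locally
dependent indicators `x (q, 0), …, x (q, 3)` on a uniform finite sample space `P`. -/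
theorem abs_prob_sub_tsum_poisson_le {Ω κ : Type*} [Fintype κ] [DecidableEq κ] (P : Finset Ω)
    (hP : P.Nonempty) (x : κ × Fin 4 → Ω → ℕ) (hx : ∀ i ω, x i ω = 0 ∨ x i ω = 1)
    (p : κ × Fin 4 → ℝ) (hp : ∀ i, 0 ≤ p i) (nbhd : κ × Fin 4 → Finset (κ × Fin 4))
    (h_self : ∀ i, i ∈ nbhd i) (h_sum : ∀ i, ∑ ω ∈ P, (x i ω : ℝ) = p i * P.card)
    (h_indep : ∀ (B : Type) [AddCommGroup B] [Module ℝ B], ∀ i, ∀ G : Ω → B,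
      (∀ ω ω', (∀ j ∉ nbhd i, x j ω = x j ω') → G ω = G ω') →
      ∑ ω ∈ P, (x i ω : ℝ) • G ω = p i • ∑ ω ∈ P, G ω)
    (lam : Fin 4 → NNReal) (h_lam : ∀ k, (lam k : ℝ) = ∑ q, p (q, k))
    (A : Set (ℕ × ℕ × ℕ × ℕ)) [DecidablePred fun ω =>
      (∑ q, x (q, 0) ω, ∑ q, x (q, 1) ω, ∑ q, x (q, 2) ω, ∑ q, x (q, 3) ω) ∈ A] :
    |((P.filter fun ω => (∑ q, x (q, 0) ω, ∑ q, x (q, 1) ω, ∑ q, x (q, 2) ω,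
        ∑ q, x (q, 3) ω) ∈ A).card : ℝ) / P.card -
      ∑' w : ℕ × ℕ × ℕ × ℕ, A.indicator (fun w =>
        ProbabilityTheory.poissonPMFReal (lam 0) w.1 *
        ProbabilityTheory.poissonPMFReal (lam 1) w.2.1 *
        ProbabilityTheory.poissonPMFReal (lam 2) w.2.2.1 *
        ProbabilityTheory.poissonPMFReal (lam 3) w.2.2.2) w| ≤
      (∑ i, ∑ j ∈ nbhd i, p i * p j * P.card +
        ∑ i, ∑ j ∈ (nbhd i).erase i, ∑ ω ∈ P, (x i ω : ℝ) * x j ω) / P.card := by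
  classical
  obtain ⟨B, i₁, i₂, i₃, i₄, τ, hτ, h_ext⟩ :=
    exists_banach_algebra_of_addCommMonoid (ℕ × ℕ × ℕ × ℕ)
  let v : Fin 4 → ℕ × ℕ × ℕ × ℕ := ![(1, 0, 0, 0), (0, 1, 0, 0), (0, 0, 1, 0), (0, 0, 0, 1)]
  let e : Fin 4 → B := fun k => τ (Multiplicative.ofAdd (v k))
  have he : ∀ k, ‖e k‖ ≤ 1 := fun k => hτ _
  have h_pow : ∀ w : ℕ × ℕ × ℕ × ℕ, e 0 ^ w.1 * (e 1 ^ w.2.1 * (e 2 ^ w.2.2.1 * e 3 ^ w.2.2.2)) =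
      τ (Multiplicative.ofAdd w) := by
    rintro ⟨a, b, c, d⟩
    simp only [e, ← map_pow, ← map_mul, ← ofAdd_nsmul, ← ofAdd_add]
    congr 2
    simp [v]
  let W : Ω → ℕ × ℕ × ℕ × ℕ := fun ω =>
    (∑ q, x (q, 0) ω, ∑ q, x (q, 1) ω, ∑ q, x (q, 2) ω, ∑ q, x (q, 3) ω)
  have h_prod : ∀ ω, ∏ i : κ × Fin 4, (1 + (x i ω : ℝ) • (e i.2 - 1)) =
      τ (Multiplicative.ofAdd (W ω)) := by
    intro ω
    have h_one : ∀ i : κ × Fin 4, 1 + (x i ω : ℝ) • (e i.2 - 1) = e i.2 ^ x i ω := fun i => by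
      rcases hx i ω with h | h <;> simp [h]
    simp_rw [h_one]
    rw [← h_pow, Fintype.prod_prod_type_right, Fin.prod_univ_four]
    simp only [Finset.prod_pow_eq_pow_sum, W, mul_assoc]
  have h_main := norm_sum_prod_sub_exp_le P (fun i ω => (x i ω : ℝ))
    (fun i ω => by rcases hx i ω with h | h <;> simp [h]) p hp (fun i => e i.2) (fun i => he i.2)
    nbhd h_self h_sum (fun i G hG => h_indep B i G fun ω ω' h =>
      hG ω ω' fun j hj => by rw [h j hj])
  simp_rw [h_prod] at h_main
  have h_exp : NormedSpace.exp (∑ i : κ × Fin 4, p i • (e i.2 - 1)) =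
      NormedSpace.exp ((lam 0 : ℝ) • (e 0 - 1)) * (NormedSpace.exp ((lam 1 : ℝ) • (e 1 - 1)) *
        (NormedSpace.exp ((lam 2 : ℝ) • (e 2 - 1)) *
          NormedSpace.exp ((lam 3 : ℝ) • (e 3 - 1)))) := by
    let _ : NormedAlgebra ℚ B := NormedAlgebra.restrictScalars ℚ ℝ B
    simp_rw [← NormedSpace.exp_add, Fintype.sum_prod_type_right, ← Finset.sum_smul, ← h_lam]
    rw [Fin.sum_univ_four, add_assoc, add_assoc]
  let po : ℕ × ℕ × ℕ × ℕ → ℝ := fun w =>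
    ProbabilityTheory.poissonPMFReal (lam 0) w.1 *
    ProbabilityTheory.poissonPMFReal (lam 1) w.2.1 *
    ProbabilityTheory.poissonPMFReal (lam 2) w.2.2.1 *
    ProbabilityTheory.poissonPMFReal (lam 3) w.2.2.2
  have h_has : HasSum (fun w => po w • τ (Multiplicative.ofAdd w))
      (NormedSpace.exp (∑ i : κ × Fin 4, p i • (e i.2 - 1))) := by
    rw [h_exp]
    convert hasSum_mul_four (fun k => ⟨hasSum_poissonPMFReal_smul_pow (lam k) (e k),
      summable_norm_poissonPMFReal_smul_pow (lam k) (he k)⟩) using 2 with w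
    rw [← h_pow]
    simp only [smul_mul_smul_comm, po, mul_assoc]
  have h_po : HasSum po 1 := by
    have h := hasSum_mul_four (g := fun k => ProbabilityTheory.poissonPMFReal (lam k))
      (y := fun _ => (1 : ℝ))
      (fun k => ⟨ProbabilityTheory.poissonPMFRealSum (lam k),
        (ProbabilityTheory.poissonPMFRealSum (lam k)).summable.norm⟩)
    simpa only [mul_one, ← mul_assoc] using h
  let f : ℕ × ℕ × ℕ × ℕ → ℝ := fun w => 2 * A.indicator 1 w - 1
  obtain ⟨ℓ, hℓ, hℓτ⟩ := h_ext f fun w => by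
    by_cases h : w ∈ A <;> simp [f, h]
    norm_num
  have h_count : ℓ (∑ ω ∈ P, τ (Multiplicative.ofAdd (W ω))) =
      2 * ((P.filter fun ω => W ω ∈ A).card : ℝ) - P.card := by
    rw [map_sum]
    simp_rw [hℓτ, f]
    rw [Finset.sum_sub_distrib, ← Finset.mul_sum, Finset.card_filter]
    simp [Set.indicator_apply]
  have h_ind : HasSum (A.indicator po)
      ((ℓ (NormedSpace.exp (∑ i : κ × Fin 4, p i • (e i.2 - 1))) + 1) / 2) := by
    have h_eq : A.indicator po =
        fun w => (ℓ (po w • τ (Multiplicative.ofAdd w)) + po w) / 2 := by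
      funext w
      rw [map_smul, hℓτ]
      by_cases h : w ∈ A <;> simp [f, h]
      ring
    rw [h_eq]
    exact ((h_has.mapL ℓ).add h_po).div_const 2
  have h_le := (hℓ _).trans h_main
  rw [map_sub, map_smul, h_count, smul_eq_mul] at h_le
  rw [show (∑' w, A.indicator _ w) = _ from h_ind.tsum_eq]
  have hP' : (0 : ℝ) < P.card := Nat.cast_pos.2 hP.card_pos
  rw [le_div_iff₀ hP', ← abs_of_pos hP', ← abs_mul, abs_of_pos hP', sub_mul,
    div_mul_cancel₀ _ hP'.ne']
  rw [abs_le] at h_le ⊢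
  constructor <;> linarith [h_le.1, h_le.2]

theorem card_board_filter_fst_eq {n i : ℕ} (hi : 1 ≤ i) :
    ((board n).filter fun x => x.1 = i).card = n - i := by
  have h : (board n).filter (fun x => x.1 = i) = {i} ×ˢ Finset.Ioc i n := by
    ext ⟨a, b⟩
    simp only [board, Finset.mem_filter, Finset.mem_product, Finset.mem_range,
      Finset.mem_singleton, Finset.mem_Ioc]
    omega
  rw [h, Finset.card_product, Finset.card_singleton, Nat.card_Ioc, one_mul]

theorem card_board_filter_snd_eq {n i : ℕ} (hi : i ≤ n) :
    ((board n).filter fun x => x.2 = i).card = i - 1 := by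
  have h : (board n).filter (fun x => x.2 = i) = Finset.Ico 1 i ×ˢ {i} := by
    ext ⟨a, b⟩
    simp only [board, Finset.mem_filter, Finset.mem_product, Finset.mem_range,
      Finset.mem_singleton, Finset.mem_Ico]
    omega
  rw [h, Finset.card_product, Finset.card_singleton, Nat.card_Ico, mul_one]

theorem card_board_mul_two (n : ℕ) : (board n).card * 2 = n * (n - 1) := by
  have h_maps : ∀ x ∈ board n, x.2 ∈ Finset.range (n + 1) := fun x hx => by
    simp only [board, Finset.mem_filter, Finset.mem_product] at hx
    exact hx.1.2
  rw [Finset.card_eq_sum_card_fiberwise h_maps, ← Finset.sum_range_id_mul_two,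
    Finset.sum_congr rfl fun i hi =>
      card_board_filter_snd_eq (Nat.lt_succ_iff.1 (Finset.mem_range.1 hi)),
    Finset.sum_range_succ']
  simp

/-- Indicators of the four ways in which a rook on `x` can be aligned with a rook on `y`:
same row, same column, column of `x` equal to row of `y`, row of `x` equal to column of `y`. -/
def aligned (k : Fin 4) (x y : ℕ × ℕ) : ℕ :=
  ![if x.1 = y.1 then 1 else 0, if x.2 = y.2 then 1 else 0, if x.2 = y.1 then 1 else 0,
    if x.1 = y.2 then 1 else 0] k

theorem aligned_eq_zero_or_one (k : Fin 4) (x y : ℕ × ℕ) :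
    aligned k x y = 0 ∨ aligned k x y = 1 := by
  fin_cases k <;> simp [aligned] <;> tauto

theorem sum_aligned (x y : ℕ × ℕ) : ∑ k, aligned k x y =
    (if x.1 = y.1 then 1 else 0) + (if x.2 = y.2 then 1 else 0) + (if x.2 = y.1 then 1 else 0) +
      (if x.1 = y.2 then 1 else 0) := by
  rw [Fin.sum_univ_four]; rfl

theorem sum_aligned_comm (x y : ℕ × ℕ) : ∑ k, aligned k x y = ∑ k, aligned k y x := by
  simp only [sum_aligned, eq_comm (a := y.1), eq_comm (a := y.2)]
  ring

theorem sum_board_sum_aligned {n : ℕ} {y : ℕ × ℕ} (hy : y ∈ board n) :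
    ∑ x ∈ board n, ∑ k, aligned k x y = 2 * (n - 1) := by
  simp only [board, Finset.mem_filter, Finset.mem_product, Finset.mem_range] at hy
  simp only [sum_aligned, Finset.sum_add_distrib, ← Finset.card_filter]
  rw [card_board_filter_fst_eq (by omega), card_board_filter_fst_eq (by omega),
    card_board_filter_snd_eq (by omega), card_board_filter_snd_eq (by omega)]
  omega

theorem sum_aligned_sq_le {n : ℕ} {x y : ℕ × ℕ} (hx : x ∈ board n) (hy : y ∈ board n) :
    ((∑ k, aligned k x y : ℕ) : ℝ) * (∑ k, aligned k x y : ℕ) ≤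
      (∑ k, aligned k x y : ℕ) + if x = y then 2 else 0 := by
  have hx' : x.1 < x.2 := (Finset.mem_filter.1 hx).2.2
  have hy' : y.1 < y.2 := (Finset.mem_filter.1 hy).2.2
  rw [sum_aligned]
  simp only [Prod.ext_iff]
  split_ifs <;> first | (exfalso; omega) | norm_num

section Resampling

variable {ι α : Type*} [Fintype ι] [DecidableEq ι]

theorem sum_piFinset_sum_update {E : Type*} [AddCommMonoid E] (S : Finset α) (a : ι)
    (F : (ι → α) → E) :
    ∑ f ∈ Fintype.piFinset (fun _ : ι => S), ∑ x ∈ S, F (Function.update f a x) =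
      S.card • ∑ f ∈ Fintype.piFinset (fun _ : ι => S), F f := by
  rw [Finset.smul_sum]
  simp_rw [← Finset.sum_const]
  rw [← Finset.sum_product', ← Finset.sum_product']
  refine Finset.sum_nbij' (fun z => (Function.update z.1 a z.2, z.1 a))
    (fun z => (Function.update z.1 a z.2, z.1 a)) ?_ ?_ ?_ ?_ ?_
  · rintro ⟨f, x⟩ hz
    simp only [Finset.mem_product, Fintype.mem_piFinset] at hz ⊢
    refine ⟨fun b => ?_, hz.1 a⟩
    rcases eq_or_ne b a with rfl | hb
    · simpa using hz.2
    · simpa [hb] using hz.1 b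
  · rintro ⟨f, x⟩ hz
    simp only [Finset.mem_product, Fintype.mem_piFinset] at hz ⊢
    refine ⟨fun b => ?_, hz.1 a⟩
    rcases eq_or_ne b a with rfl | hb
    · simpa using hz.2
    · simpa [hb] using hz.1 b
  · rintro ⟨f, x⟩ _
    simp
  · rintro ⟨f, x⟩ _
    simp
  · rintro ⟨f, x⟩ _
    rfl

theorem sum_piFinset_smul_of_update_eq {E : Type*} [AddCommGroup E] [Module ℝ E] {S : Finset α}
    (hS : S.Nonempty) {a b : ι} (hab : a ≠ b) (h : α → α → ℝ) (G : (ι → α) → E)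
    (ha : ∀ f x, G (Function.update f a x) = G f) (hb : ∀ f x, G (Function.update f b x) = G f) :
    ∑ f ∈ Fintype.piFinset (fun _ : ι => S), h (f a) (f b) • G f =
      ((∑ y ∈ S, ∑ x ∈ S, h x y) / (S.card : ℝ) ^ 2) •
        ∑ f ∈ Fintype.piFinset (fun _ : ι => S), G f := by
  have hS' : (S.card : ℝ) ≠ 0 := Nat.cast_ne_zero.2 hS.card_ne_zero
  have h₁ := sum_piFinset_sum_update S a fun f => h (f a) (f b) • G f
  have h₂ := sum_piFinset_sum_update S b fun f => ∑ x ∈ S, h x (f b) • G f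
  simp only [ha, hb, Function.update_self, Function.update_of_ne hab.symm] at h₁ h₂
  rw [h₁] at h₂
  rw [← Nat.cast_smul_eq_nsmul ℝ, ← Nat.cast_smul_eq_nsmul ℝ, smul_smul, ← sq] at h₂
  simp_rw [← Finset.sum_smul, ← Finset.smul_sum] at h₂
  rw [div_eq_inv_mul, mul_smul, h₂, smul_smul, inv_mul_cancel₀ (pow_ne_zero 2 hS'), one_smul]

end Resampling

theorem sum_aligned_mul_of_update_eq {n r : ℕ} (hn : 2 ≤ n) {a b : Fin r} (hab : a ≠ b)
    (G : (Fin r → ℕ × ℕ) → ℝ) (ha : ∀ f x, G (Function.update f a x) = G f) :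
    ∑ f ∈ Fintype.piFinset (fun _ : Fin r => board n),
        ((∑ k, aligned k (f a) (f b) : ℕ) : ℝ) * G f =
      4 / n * ∑ f ∈ Fintype.piFinset (fun _ : Fin r => board n), G f := by
  have h := sum_piFinset_sum_update (board n) a
    fun f => ((∑ k, aligned k (f a) (f b) : ℕ) : ℝ) * G f
  simp only [ha, Function.update_self, Function.update_of_ne hab.symm] at h
  simp_rw [← Finset.sum_mul] at h
  have h' : ∀ f ∈ Fintype.piFinset (fun _ : Fin r => board n),
      (∑ x ∈ board n, ((∑ k, aligned k x (f b) : ℕ) : ℝ)) * G f = 2 * ((n : ℝ) - 1) * G f := by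
    intro f hf
    rw [← Nat.cast_sum, sum_board_sum_aligned (Fintype.mem_piFinset.1 hf b), Nat.cast_mul,
      Nat.cast_sub (by omega)]
    simp
  rw [Finset.sum_congr rfl h', ← Finset.mul_sum, nsmul_eq_mul] at h
  have h_card : ((board n).card : ℝ) * 2 = n * (n - 1) := by
    have h_nat := congrArg (Nat.cast : ℕ → ℝ) (card_board_mul_two n)
    rwa [Nat.cast_mul, Nat.cast_mul, Nat.cast_sub (by omega), Nat.cast_ofNat,
      Nat.cast_one] at h_nat
  have hn₁ : (2 : ℝ) ≤ n := by exact_mod_cast hn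
  rw [div_mul_eq_mul_div, eq_div_iff (by positivity)]
  have hn₂ : (n : ℝ) - 1 ≠ 0 := by linarith
  apply mul_left_cancel₀ hn₂
  linear_combination -2 * h - (∑ f ∈ Fintype.piFinset (fun _ : Fin r => board n),
        ((∑ k, aligned k (f a) (f b) : ℕ) : ℝ) * G f) * h_card

/-- The pairs `q` and `q'` have a common entry. -/
def PairsMeet {r : ℕ} (q q' : Fin r × Fin r) : Prop :=
  q'.1 = q.1 ∨ q'.1 = q.2 ∨ q'.2 = q.1 ∨ q'.2 = q.2

instance {r : ℕ} (q q' : Fin r × Fin r) : Decidable (PairsMeet q q') :=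
  inferInstanceAs (Decidable (_ ∨ _))

theorem card_pairs_meeting_le {r : ℕ} {q : Fin r × Fin r} (hq : q.1 < q.2) :
    (Finset.univ.filter fun q' : Fin r × Fin r =>
      q'.1 < q'.2 ∧ PairsMeet q q' ∧ q' ≠ q).card ≤ 2 * (r - 2) := by
  obtain ⟨a, b⟩ := q
  simp only at hq
  have h_card : ((Finset.univ.erase a).erase b).card = r - 2 := by
    rw [Finset.card_erase_of_mem (by simp [hq.ne']), Finset.card_erase_of_mem (by simp),
      Finset.card_univ, Fintype.card_fin]
    omega
  have h_sub : (Finset.univ.filter fun q' : Fin r × Fin r =>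
      q'.1 < q'.2 ∧ PairsMeet (a, b) q' ∧ q' ≠ (a, b)) ⊆
      ((Finset.univ.erase a).erase b).image (fun c => (min a c, max a c)) ∪
      ((Finset.univ.erase a).erase b).image (fun c => (min b c, max b c)) := by
    intro q' h
    obtain ⟨c, d⟩ := q'
    obtain ⟨hcd, hm, hne⟩ := (Finset.mem_filter.1 h).2
    simp only [PairsMeet, ne_eq, Prod.mk.injEq] at hcd hm hne
    simp only [Finset.mem_union, Finset.mem_image, Finset.mem_erase, Finset.mem_univ, and_true,
      Prod.mk.injEq]
    rcases hm with rfl | rfl | rfl | rfl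
    · exact Or.inl ⟨d, ⟨fun h => hne ⟨rfl, h⟩, hcd.ne'⟩, min_eq_left hcd.le, max_eq_right hcd.le⟩
    · exact Or.inr ⟨d, ⟨hcd.ne', (hq.trans hcd).ne'⟩, min_eq_left hcd.le, max_eq_right hcd.le⟩
    · exact Or.inl ⟨c, ⟨(hcd.trans hq).ne, hcd.ne⟩, min_eq_right hcd.le, max_eq_left hcd.le⟩
    · exact Or.inr ⟨c, ⟨hcd.ne, fun h => hne ⟨h, rfl⟩⟩, min_eq_right hcd.le, max_eq_left hcd.le⟩
  refine (Finset.card_le_card h_sub).trans ((Finset.card_union_le _ _).trans ?_)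
  have h₁ := Finset.card_image_le (s := (Finset.univ.erase a).erase b)
    (f := fun c => (min a c, max a c))
  have h₂ := Finset.card_image_le (s := (Finset.univ.erase a).erase b)
    (f := fun c => (min b c, max b c))
  omega

theorem sum_pairs_meeting_le {r : ℕ} (hr : 2 ≤ r) {q : Fin r × Fin r} (hq : q.1 < q.2)
    (F : Fin r × Fin r → ℝ) {c : ℝ} (hc : 0 ≤ c) (h₀ : ∀ q', ¬ q'.1 < q'.2 → F q' = 0)
    (h_le : ∀ q', q'.1 < q'.2 → q' ≠ q → F q' ≤ c) :
    ∑ q', (if PairsMeet q q' then F q' else 0) ≤ F q + 2 * ((r : ℝ) - 2) * c := by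
  have h_self : PairsMeet q q := Or.inl rfl
  rw [← Finset.add_sum_erase _ _ (Finset.mem_univ q), if_pos h_self]
  refine add_le_add le_rfl ?_
  calc ∑ q' ∈ univ.erase q, (if PairsMeet q q' then F q' else 0)
      ≤ ∑ q' ∈ univ.erase q, if q'.1 < q'.2 ∧ PairsMeet q q' ∧ q' ≠ q then c else 0 := by
        refine Finset.sum_le_sum fun q' hq' => ?_
        have hne := (Finset.mem_erase.1 hq').1
        by_cases h_lt : q'.1 < q'.2
        · by_cases hm : PairsMeet q q'
          · simpa [h_lt, hm, hne] using h_le q' h_lt hne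
          · simp [hm]
        · simp [h_lt, h₀ q' h_lt]
    _ ≤ ∑ q', if q'.1 < q'.2 ∧ PairsMeet q q' ∧ q' ≠ q then c else 0 := by
        refine Finset.sum_le_sum_of_subset_of_nonneg (Finset.erase_subset _ _) fun _ _ _ => ?_
        split_ifs <;> simp [hc]
    _ = ((Finset.univ.filter fun q' : Fin r × Fin r =>
          q'.1 < q'.2 ∧ PairsMeet q q' ∧ q' ≠ q).card : ℝ) * c := by
        rw [← Finset.sum_filter, Finset.sum_const, nsmul_eq_mul]
    _ ≤ 2 * ((r : ℝ) - 2) * c := by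
        have h : ((Finset.univ.filter fun q' : Fin r × Fin r =>
          q'.1 < q'.2 ∧ PairsMeet q q' ∧ q' ≠ q).card : ℝ) ≤ (2 * (r - 2) : ℕ) := by
          exact_mod_cast card_pairs_meeting_le hq
        rw [Nat.cast_mul, Nat.cast_sub hr] at h
        push_cast at h
        gcongr

theorem card_ordered_pairs_mul_two (r : ℕ) :
    (Finset.univ.filter fun q : Fin r × Fin r => q.1 < q.2).card * 2 = r * (r - 1) := by
  have h : (Finset.univ.filter fun q : Fin r × Fin r => q.1 < q.2).card = ∑ i : Fin r, (i : ℕ) := by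
    rw [Finset.card_filter, Fintype.sum_prod_type_right]
    refine Finset.sum_congr rfl fun i _ => ?_
    rw [← Finset.card_filter, Finset.filter_gt_eq_Iio, Fin.card_Iio]
  rw [h, Fin.sum_univ_eq_sum_range (fun i => i), Finset.sum_range_id_mul_two]

theorem sum_sum_pairs_meeting {r : ℕ} (g : (Fin r × Fin r) × Fin 4 → ℝ) :
    ∑ i, ∑ j ∈ Finset.univ.filter (fun j : (Fin r × Fin r) × Fin 4 => PairsMeet i.1 j.1),
      g i * g j =
    ∑ q, ∑ q', if PairsMeet q q' then (∑ k, g (q, k)) * ∑ k, g (q', k) else 0 := by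
  simp_rw [Finset.sum_filter]
  rw [Fintype.sum_prod_type]
  refine Finset.sum_congr rfl fun q _ => ?_
  have h : ∀ k, ∑ j : (Fin r × Fin r) × Fin 4, (if PairsMeet q j.1 then g (q, k) * g j else 0) =
      ∑ q', ∑ l, if PairsMeet q q' then g (q, k) * g (q', l) else 0 :=
    fun k => Fintype.sum_prod_type _
  rw [Finset.sum_congr rfl fun k _ => h k, Finset.sum_comm]
  refine Finset.sum_congr rfl fun q' _ => ?_
  split_ifs
  · rw [Finset.sum_mul_sum]
  · simp

/-- The placements of `r` labelled rooks on the board. -/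
abbrev placements (n r : ℕ) : Finset (Fin r → ℕ × ℕ) :=
  Fintype.piFinset fun _ => board n

/-- Indicator that the rooks of an increasing pair are aligned in the given way. -/
def pairAligned {r : ℕ} (i : (Fin r × Fin r) × Fin 4) (f : Fin r → ℕ × ℕ) : ℕ :=
  if i.1.1 < i.1.2 then aligned i.2 (f i.1.1) (f i.1.2) else 0

/-- The probability that the rooks of an increasing pair are aligned in the given way. -/
noncomputable def pairAlignedProb (n : ℕ) {r : ℕ} (i : (Fin r × Fin r) × Fin 4) : ℝ :=
  (∑ f ∈ placements n r, (pairAligned i f : ℝ)) / (placements n r).card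

theorem board_nonempty {n : ℕ} (hn : 2 ≤ n) : (board n).Nonempty :=
  ⟨(1, 2), by simp [board]; omega⟩

theorem placements_nonempty {n : ℕ} (hn : 2 ≤ n) (r : ℕ) : (placements n r).Nonempty :=
  Fintype.piFinset_nonempty.2 fun _ => board_nonempty hn

theorem card_placements_pos {n : ℕ} (hn : 2 ≤ n) (r : ℕ) : (0 : ℝ) < (placements n r).card :=
  Nat.cast_pos.2 (placements_nonempty hn r).card_pos

theorem pairAligned_eq_zero_or_one {r : ℕ} (i : (Fin r × Fin r) × Fin 4) (f : Fin r → ℕ × ℕ) :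
    pairAligned i f = 0 ∨ pairAligned i f = 1 := by
  unfold pairAligned
  split_ifs
  · exact aligned_eq_zero_or_one _ _ _
  · exact Or.inl rfl

theorem pairAligned_mul_self {r : ℕ} (i : (Fin r × Fin r) × Fin 4) (f : Fin r → ℕ × ℕ) :
    (pairAligned i f : ℝ) * pairAligned i f = pairAligned i f := by
  rcases pairAligned_eq_zero_or_one i f with h | h <;> simp [h]

theorem pairAligned_update {r : ℕ} {i : (Fin r × Fin r) × Fin 4} {a : Fin r} (h₁ : i.1.1 ≠ a)
    (h₂ : i.1.2 ≠ a) (f : Fin r → ℕ × ℕ) (x : ℕ × ℕ) :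
    pairAligned i (Function.update f a x) = pairAligned i f := by
  simp [pairAligned, h₁, h₂]

theorem sum_pairAligned_of_lt {r : ℕ} {q : Fin r × Fin r} (hq : q.1 < q.2) (f : Fin r → ℕ × ℕ) :
    ∑ k, (pairAligned (q, k) f : ℝ) = (∑ k, aligned k (f q.1) (f q.2) : ℕ) := by
  simp [pairAligned, hq]

theorem pairAligned_of_not_lt {r : ℕ} {i : (Fin r × Fin r) × Fin 4} (hi : ¬ i.1.1 < i.1.2)
    (f : Fin r → ℕ × ℕ) : pairAligned i f = 0 := by
  simp [pairAligned, hi]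

theorem pairAlignedProb_of_not_lt {n r : ℕ} {i : (Fin r × Fin r) × Fin 4}
    (hi : ¬ i.1.1 < i.1.2) : pairAlignedProb n i = 0 := by
  simp [pairAlignedProb, pairAligned_of_not_lt hi]

theorem sum_pairAligned_smul {n r : ℕ} (hn : 2 ≤ n) {B : Type*} [AddCommGroup B] [Module ℝ B]
    (i : (Fin r × Fin r) × Fin 4) (G : (Fin r → ℕ × ℕ) → B)
    (hG : ∀ f f', (∀ j : (Fin r × Fin r) × Fin 4, ¬ PairsMeet i.1 j.1 →
      pairAligned j f = pairAligned j f') → G f = G f') :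
    ∑ f ∈ placements n r, (pairAligned i f : ℝ) • G f =
      pairAlignedProb n i • ∑ f ∈ placements n r, G f := by
  by_cases hi : i.1.1 < i.1.2
  · have h_eq : ∀ f : Fin r → ℕ × ℕ,
        (pairAligned i f : ℝ) = (aligned i.2 (f i.1.1) (f i.1.2) : ℝ) := fun f => by
      simp [pairAligned, hi]
    have hP : ((placements n r).card : ℝ) ≠ 0 := (card_placements_pos hn r).ne'
    have h_one := sum_piFinset_smul_of_update_eq (board_nonempty hn) hi.ne
      (fun x y => (aligned i.2 x y : ℝ)) (fun _ : Fin r → ℕ × ℕ => (1 : ℝ)) (fun _ _ => rfl)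
      fun _ _ => rfl
    simp only [smul_eq_mul, mul_one, Finset.sum_const, nsmul_eq_mul] at h_one
    have h_prob : pairAlignedProb n i =
        (∑ y ∈ board n, ∑ x ∈ board n, (aligned i.2 x y : ℝ)) / ((board n).card : ℝ) ^ 2 := by
      rw [pairAlignedProb, Finset.sum_congr rfl fun f _ => h_eq f, h_one, mul_div_cancel_right₀ _ hP]
    rw [h_prob, Finset.sum_congr rfl fun f _ => by rw [h_eq f]]
    refine sum_piFinset_smul_of_update_eq (board_nonempty hn) hi.ne
      (fun x y => (aligned i.2 x y : ℝ)) G (fun f x => hG _ _ fun j hj => ?_)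
      fun f x => hG _ _ fun j hj => ?_
    · exact pairAligned_update (fun h => hj (Or.inl h))
        (fun h => hj (Or.inr (Or.inr (Or.inl h)))) f x
    · exact pairAligned_update (fun h => hj (Or.inr (Or.inl h)))
        (fun h => hj (Or.inr (Or.inr (Or.inr h)))) f x
  · simp [pairAligned_of_not_lt hi, pairAlignedProb_of_not_lt hi]

theorem sum_sum_pairAligned {n r : ℕ} (hn : 2 ≤ n) {q : Fin r × Fin r} (hq : q.1 < q.2) :
    ∑ f ∈ placements n r, ∑ k, (pairAligned (q, k) f : ℝ) = 4 / n * (placements n r).card := by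
  have h := sum_aligned_mul_of_update_eq hn hq.ne (fun _ => 1) fun _ _ => rfl
  simp only [mul_one, Finset.sum_const, nsmul_eq_mul] at h
  simp only [sum_pairAligned_of_lt hq, h]

theorem sum_pairAlignedProb {n r : ℕ} (hn : 2 ≤ n) {q : Fin r × Fin r} (hq : q.1 < q.2) :
    ∑ k, pairAlignedProb n (q, k) = 4 / n := by
  simp only [pairAlignedProb]
  rw [← Finset.sum_div, Finset.sum_comm, sum_sum_pairAligned hn hq,
    mul_div_cancel_right₀ _ (card_placements_pos hn r).ne']

theorem sum_mul_sum_pairAligned {n r : ℕ} (hn : 2 ≤ n) {q q' : Fin r × Fin r} (hq : q.1 < q.2)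
    (hq' : q'.1 < q'.2) (hne : q' ≠ q) :
    ∑ f ∈ placements n r, (∑ k, (pairAligned (q, k) f : ℝ)) * ∑ k, (pairAligned (q', k) f : ℝ) =
      (4 / n) ^ 2 * (placements n r).card := by
  have h_update : ∀ a, q'.1 ≠ a → q'.2 ≠ a → ∀ f x,
      ∑ k, (pairAligned (q', k) (Function.update f a x) : ℝ) =
        ∑ k, (pairAligned (q', k) f : ℝ) := fun a h₁ h₂ f x =>
    Finset.sum_congr rfl fun k _ => by rw [pairAligned_update h₁ h₂]
  have h_cases : (q'.1 ≠ q.1 ∧ q'.2 ≠ q.1) ∨ (q'.1 ≠ q.2 ∧ q'.2 ≠ q.2) := by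
    rw [Ne, Prod.ext_iff] at hne
    omega
  have h : ∑ f ∈ placements n r,
      (∑ k, (pairAligned (q, k) f : ℝ)) * ∑ k, (pairAligned (q', k) f : ℝ) =
      4 / n * ∑ f ∈ placements n r, ∑ k, (pairAligned (q', k) f : ℝ) := by
    rcases h_cases with ⟨h₁, h₂⟩ | ⟨h₁, h₂⟩
    · simp_rw [sum_pairAligned_of_lt hq]
      exact sum_aligned_mul_of_update_eq hn hq.ne _ (h_update _ h₁ h₂)
    · simp_rw [sum_pairAligned_of_lt hq]
      rw [Finset.sum_congr rfl fun f _ => by rw [sum_aligned_comm]]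
      exact sum_aligned_mul_of_update_eq hn hq.ne' _ (h_update _ h₁ h₂)
  rw [h, sum_sum_pairAligned hn hq', sq, mul_assoc]

theorem sum_sq_sum_pairAligned_le {n r : ℕ} (hn : 2 ≤ n) {q : Fin r × Fin r} (hq : q.1 < q.2) :
    ∑ f ∈ placements n r, (∑ k, (pairAligned (q, k) f : ℝ)) * ∑ k, (pairAligned (q, k) f : ℝ) ≤
      ∑ f ∈ placements n r, ∑ k, (pairAligned (q, k) f : ℝ) +
        8 / (n : ℝ) ^ 2 * (placements n r).card := by
  have hn₁ : (2 : ℝ) ≤ n := by exact_mod_cast hn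
  have h_card : ((board n).card : ℝ) * 2 = n * (n - 1) := by
    have h_nat := congrArg (Nat.cast : ℕ → ℝ) (card_board_mul_two n)
    rwa [Nat.cast_mul, Nat.cast_mul, Nat.cast_sub (by omega), Nat.cast_ofNat,
      Nat.cast_one] at h_nat
  have h_coincide := sum_piFinset_sum_update (board n) q.1
    fun f : Fin r → ℕ × ℕ => if f q.1 = f q.2 then (2 : ℝ) else 0
  simp only [Function.update_self, Function.update_of_ne hq.ne', Finset.sum_ite_eq',
    nsmul_eq_mul] at h_coincide
  rw [Finset.sum_congr rfl fun f hf => if_pos (Fintype.mem_piFinset.1 hf q.2), Finset.sum_const,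
    nsmul_eq_mul] at h_coincide
  have h_le : ∑ f ∈ placements n r, (if f q.1 = f q.2 then (2 : ℝ) else 0) ≤
      8 / (n : ℝ) ^ 2 * (placements n r).card := by
    have h₀ : 0 ≤ ∑ f ∈ placements n r, (if f q.1 = f q.2 then (2 : ℝ) else 0) :=
      Finset.sum_nonneg fun f _ => by split_ifs <;> norm_num
    rw [div_mul_eq_mul_div, le_div_iff₀ (by positivity)]
    change _ = _ * ∑ f ∈ placements n r, _ at h_coincide
    nlinarith [mul_nonneg h₀ (by nlinarith : (0 : ℝ) ≤ n * (n - 2))]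
  refine le_trans ?_ (add_le_add le_rfl h_le)
  rw [← Finset.sum_add_distrib]
  refine Finset.sum_le_sum fun f hf => ?_
  simp only [sum_pairAligned_of_lt hq]
  exact sum_aligned_sq_le (Fintype.mem_piFinset.1 hf _) (Fintype.mem_piFinset.1 hf _)

theorem sum_meeting_le {n r : ℕ} (hn : 2 ≤ n) (hr : 2 ≤ r) {q : Fin r × Fin r} (hq : q.1 < q.2) :
    (∑ q' : Fin r × Fin r, if PairsMeet q q' then
        (∑ k, pairAlignedProb n (q, k)) * ∑ k, pairAlignedProb n (q', k) else 0) *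
          (placements n r).card +
      (∑ q' : Fin r × Fin r, (if PairsMeet q q' then
        ∑ f ∈ placements n r,
          (∑ k, (pairAligned (q, k) f : ℝ)) * ∑ k, (pairAligned (q', k) f : ℝ) else 0) -
        ∑ f ∈ placements n r, ∑ k, (pairAligned (q, k) f : ℝ)) ≤
      64 / (n : ℝ) ^ 2 * ((r : ℝ) - 3 / 2) * (placements n r).card := by
  have h₁ := sum_pairs_meeting_le hr hq
    (fun q' => (∑ k, pairAlignedProb n (q, k)) * ∑ k, pairAlignedProb n (q', k))
    (c := (4 / n) ^ 2) (by positivity)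
    (fun q' hq' => by simp [pairAlignedProb_of_not_lt (i := (q', _)) hq'])
    fun q' hq' _ => by rw [sum_pairAlignedProb hn hq, sum_pairAlignedProb hn hq', sq]
  have h₂ := sum_pairs_meeting_le hr hq
    (fun q' => ∑ f ∈ placements n r,
      (∑ k, (pairAligned (q, k) f : ℝ)) * ∑ k, (pairAligned (q', k) f : ℝ))
    (c := (4 / n) ^ 2 * (placements n r).card) (by positivity)
    (fun q' hq' => by simp [pairAligned_of_not_lt (i := (q', _)) hq'])
    fun q' hq' hne => (sum_mul_sum_pairAligned hn hq hq' hne).le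
  have h₃ := sum_sq_sum_pairAligned_le (r := r) hn hq
  rw [sum_pairAlignedProb hn hq] at h₁ ⊢
  have h₄ := mul_le_mul_of_nonneg_right h₁ (card_placements_pos hn r).le
  have hn₁ : (n : ℝ) ≠ 0 := by positivity
  refine (add_le_add h₄ (sub_le_sub_right (h₂.trans (add_le_add h₃ le_rfl)) _)).trans
    (le_of_sub_nonneg ?_)
  have h_pos : 0 ≤ 8 / (n : ℝ) ^ 2 * (placements n r).card := by positivity
  refine h_pos.trans_eq ?_
  field_simp
  ring

theorem sum_nbhd_le {n r : ℕ} (hn : 2 ≤ n) (hr : 2 ≤ r) :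
    ∑ i : (Fin r × Fin r) × Fin 4,
        ∑ j ∈ Finset.univ.filter (fun j : (Fin r × Fin r) × Fin 4 => PairsMeet i.1 j.1),
          pairAlignedProb n i * pairAlignedProb n j * (placements n r).card +
      ∑ i : (Fin r × Fin r) × Fin 4,
        ∑ j ∈ (Finset.univ.filter
            (fun j : (Fin r × Fin r) × Fin 4 => PairsMeet i.1 j.1)).erase i,
          ∑ f ∈ placements n r, (pairAligned i f : ℝ) * pairAligned j f ≤
      32 / (n : ℝ) ^ 2 * (r * (r - 1) * (r - 3 / 2)) * (placements n r).card := by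
  have h_fst : ∑ i : (Fin r × Fin r) × Fin 4,
        ∑ j ∈ Finset.univ.filter (fun j : (Fin r × Fin r) × Fin 4 => PairsMeet i.1 j.1),
          pairAlignedProb n i * pairAlignedProb n j * (placements n r).card =
      ∑ q : Fin r × Fin r, (∑ q' : Fin r × Fin r, if PairsMeet q q' then
        (∑ k, pairAlignedProb n (q, k)) * ∑ k, pairAlignedProb n (q', k) else 0) *
          (placements n r).card := by
    rw [← Finset.sum_mul, ← sum_sum_pairs_meeting, Finset.sum_mul]
    exact Finset.sum_congr rfl fun i _ => (Finset.sum_mul _ _ _).symm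
  have h_snd : ∑ i : (Fin r × Fin r) × Fin 4,
        ∑ j ∈ (Finset.univ.filter
            (fun j : (Fin r × Fin r) × Fin 4 => PairsMeet i.1 j.1)).erase i,
          ∑ f ∈ placements n r, (pairAligned i f : ℝ) * pairAligned j f =
      ∑ q : Fin r × Fin r, (∑ q' : Fin r × Fin r, (if PairsMeet q q' then
        ∑ f ∈ placements n r,
          (∑ k, (pairAligned (q, k) f : ℝ)) * ∑ k, (pairAligned (q', k) f : ℝ) else 0) -
        ∑ f ∈ placements n r, ∑ k, (pairAligned (q, k) f : ℝ)) := by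
    have h_erase : ∀ i : (Fin r × Fin r) × Fin 4, ∑ j ∈ (Finset.univ.filter
            (fun j : (Fin r × Fin r) × Fin 4 => PairsMeet i.1 j.1)).erase i,
          ∑ f ∈ placements n r, (pairAligned i f : ℝ) * pairAligned j f =
        ∑ f ∈ placements n r, ∑ j ∈ Finset.univ.filter
            (fun j : (Fin r × Fin r) × Fin 4 => PairsMeet i.1 j.1),
          (pairAligned i f : ℝ) * pairAligned j f -
        ∑ f ∈ placements n r, (pairAligned i f : ℝ) := fun i => by
      rw [Finset.sum_erase_eq_sub (Finset.mem_filter.2 ⟨Finset.mem_univ i, Or.inl rfl⟩),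
        Finset.sum_comm]
      simp_rw [pairAligned_mul_self]
    rw [Finset.sum_congr rfl fun i _ => h_erase i, Finset.sum_sub_distrib, Finset.sum_sub_distrib,
      Finset.sum_comm]
    congr 1
    · rw [Finset.sum_congr rfl fun f _ => sum_sum_pairs_meeting fun i => (pairAligned i f : ℝ),
        Finset.sum_comm]
      refine Finset.sum_congr rfl fun q _ => ?_
      rw [Finset.sum_comm]
      refine Finset.sum_congr rfl fun q' _ => ?_
      split_ifs <;> simp
    · rw [Fintype.sum_prod_type]
      exact Finset.sum_congr rfl fun q _ => Finset.sum_comm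
  have h_card : ((Finset.univ.filter fun q : Fin r × Fin r => q.1 < q.2).card : ℝ) * 2 =
      r * (r - 1) := by
    have h_nat := congrArg (Nat.cast : ℕ → ℝ) (card_ordered_pairs_mul_two r)
    rwa [Nat.cast_mul, Nat.cast_mul, Nat.cast_sub (by omega), Nat.cast_ofNat,
      Nat.cast_one] at h_nat
  rw [h_fst, h_snd, ← Finset.sum_add_distrib]
  calc _ ≤ ∑ q : Fin r × Fin r, if q.1 < q.2 then
        64 / (n : ℝ) ^ 2 * ((r : ℝ) - 3 / 2) * (placements n r).card else 0 := by
        refine Finset.sum_le_sum fun q _ => ?_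
        split_ifs with hq
        · exact sum_meeting_le hn hr hq
        · simp [pairAligned_of_not_lt (i := (q, _)) hq, pairAlignedProb_of_not_lt (i := (q, _)) hq]
    _ = _ := by
        rw [← Finset.sum_filter, Finset.sum_const, nsmul_eq_mul, ← h_card]
        ring

theorem card_placements (n r : ℕ) : ((placements n r).card : ℝ) = ((board n).card : ℝ) ^ r := by
  rw [Fintype.card_piFinset_const, Nat.cast_pow]

theorem rookProb_eq_card_div (n r : ℕ) (E : (Fin r → ℕ × ℕ) → Prop) [DecidablePred E] :
    rookProb n r E = (((placements n r).filter E).card : ℝ) / (placements n r).card := by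
  have h : {f : Fin r → ℕ × ℕ | (∀ a, f a ∈ board n) ∧ E f} = (placements n r).filter E := by
    ext f
    simp
  rw [rookProb, card_placements, h, Set.ncard_coe_finset]

theorem rookExp_sum_pairAligned (n r : ℕ) (k : Fin 4) :
    rookExp n r (fun f => ∑ q, pairAligned (q, k) f) =
      ∑ q : Fin r × Fin r, pairAlignedProb n (q, k) := by
  simp only [rookExp, pairAlignedProb, ← card_placements, Nat.cast_sum]
  rw [← Finset.sum_div, Finset.sum_comm]

theorem pairAlignedProb_nonneg (n : ℕ) {r : ℕ} (i : (Fin r × Fin r) × Fin 4) :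
    0 ≤ pairAlignedProb n i :=
  div_nonneg (Finset.sum_nonneg fun _ _ => Nat.cast_nonneg _) (Nat.cast_nonneg _)

theorem sum_pairAligned_eq (r : ℕ) :
    (fun f => ∑ q : Fin r × Fin r, pairAligned (q, 0) f) = WRR r ∧
    (fun f => ∑ q : Fin r × Fin r, pairAligned (q, 1) f) = WCC r ∧
    (fun f => ∑ q : Fin r × Fin r, pairAligned (q, 2) f) = WRC r ∧
    (fun f => ∑ q : Fin r × Fin r, pairAligned (q, 3) f) = WCR r := by
  refine ⟨?_, ?_, ?_, ?_⟩ <;> funext f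
  · simp_rw [WRR, Finset.card_filter, ite_and]; rfl
  · simp_rw [WCC, Finset.card_filter, ite_and]; rfl
  · simp_rw [WRC, Finset.card_filter, ite_and]; rfl
  · simp_rw [WCR, Finset.card_filter, ite_and]; rfl

theorem thirty_two_div_sq_mul_le {n : ℝ} (hn : 2 ≤ n) {c : ℝ} (hc : 0 ≤ c) :
    32 / n ^ 2 * c ≤
      c * (362 / (9 * n ^ 2)) * ((n * (n - 301/181) + 166) / (n - 1) ^ 2) := by
  have h : 1 ≤ (n * (n - 301/181) + 166) / (n - 1) ^ 2 := by
    rw [one_le_div (by nlinarith)]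
    nlinarith
  have h' : 32 / n ^ 2 * c ≤ c * (362 / (9 * n ^ 2)) := by
    rw [mul_comm c, div_mul_eq_div_div]
    gcongr
    norm_num
  exact h'.trans (le_mul_of_one_le_right (by positivity) h)

/-- for `n ≥ 2`, `r ≥ 2`, and `r` rooks placed independently and uniformly at
random on `B_n`, the total variation distance between the law of `(W_RR, W_CC, W_RC, W_CR)`
and the law of `(S_RR, S_CC, S_RC, S_CR)`, a quadruple of independent Poisson random variables
with means `E W_RR, E W_CC, E W_RC, E W_CR` respectively, is at most
`d = r(r−1)(r−3/2)·(362/(9n²))·((n(n−301/181)+166)/(n−1)²)`. -/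
theorem rook_counts_poisson_approx (n r : ℕ) (hn : 2 ≤ n) (hr : 2 ≤ r) :
    (⨆ A : Set (ℕ × ℕ × ℕ × ℕ),
      |rookProb n r (fun f => (WRR r f, WCC r f, WRC r f, WCR r f) ∈ A) -
        ∑' w : ℕ × ℕ × ℕ × ℕ,
          A.indicator
            (fun w =>
              ProbabilityTheory.poissonPMFReal
                  (Real.toNNReal (rookExp n r (WRR r))) w.1 *
                ProbabilityTheory.poissonPMFReal
                  (Real.toNNReal (rookExp n r (WCC r))) w.2.1 *
                ProbabilityTheory.poissonPMFReal
                  (Real.toNNReal (rookExp n r (WRC r))) w.2.2.1 *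
                ProbabilityTheory.poissonPMFReal
                  (Real.toNNReal (rookExp n r (WCR r))) w.2.2.2) w|)
      ≤ (r : ℝ) * ((r : ℝ) - 1) * ((r : ℝ) - 3/2) * (362 / (9 * (n : ℝ) ^ 2)) *
          (((n : ℝ) * ((n : ℝ) - 301/181) + 166) / ((n : ℝ) - 1) ^ 2) := by
  obtain ⟨hRR, hCC, hRC, hCR⟩ := sum_pairAligned_eq r
  refine ciSup_le fun A => ?_
  classical
  have h_rookExp : ∀ k, (Real.toNNReal (rookExp n r fun f => ∑ q, pairAligned (q, k) f) : ℝ) =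
      ∑ q : Fin r × Fin r, pairAlignedProb n (q, k) := fun k => by
    rw [rookExp_sum_pairAligned,
      Real.coe_toNNReal _ (Finset.sum_nonneg fun q _ => pairAlignedProb_nonneg n _)]
  have h := abs_prob_sub_tsum_poisson_le (placements n r) (placements_nonempty hn r) pairAligned
    pairAligned_eq_zero_or_one (pairAlignedProb n) (pairAlignedProb_nonneg n)
    (fun i => Finset.univ.filter fun j => PairsMeet i.1 j.1)
    (fun i => Finset.mem_filter.2 ⟨Finset.mem_univ i, Or.inl rfl⟩)
    (fun i => (div_mul_cancel₀ _ (card_placements_pos hn r).ne').symm)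
    (fun B _ _ i G hG => sum_pairAligned_smul hn i G fun f f' h => hG f f' fun j hj =>
      h j fun h_meet => hj (Finset.mem_filter.2 ⟨Finset.mem_univ j, h_meet⟩))
    (fun k => Real.toNNReal (rookExp n r fun f => ∑ q, pairAligned (q, k) f)) h_rookExp A
  have h_bound := div_le_of_le_mul₀ (card_placements_pos hn r).le
    (by have : (2 : ℝ) ≤ r := by exact_mod_cast hr
        have : 0 ≤ (r : ℝ) - 1 := by linarith
        have : 0 ≤ (r : ℝ) - 3 / 2 := by linarith
        positivity) (sum_nbhd_le hn hr)
  rw [rookProb_eq_card_div, ← hRR, ← hCC, ← hRC, ← hCR]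
  refine h.trans (h_bound.trans (thirty_two_div_sq_mul_le (by exact_mod_cast hn) ?_))
  have hr' : (2 : ℝ) ≤ r := by exact_mod_cast hr
  exact mul_nonneg (mul_nonneg (by linarith) (by linarith)) (by linarith)
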